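/- Over the Jacobson algebra R, every quotient of an injective module is injective: if M is an injective left R-module and N is an R-submodule of M, then M ⧸ N is an injective left R-module. -/

import Mathlib

noncomputable section

universe u

/-- The defining relation `X * Y = 1` of the Jacobson algebra. -/
inductive JRel (K : Type u) [Field K] : FreeAlgebra K (Fin 2) → FreeAlgebra K (Fin 2) → Prop
  | rel : JRel K (FreeAlgebra.ι K 0 * FreeAlgebra.ι K 1) 1

/-- The Jacobson algebra `K⟨X, Y | XY = 1⟩`. -/
abbrev Jacobson (K : Type u) [Field K] := RingQuot (JRel K)

variable (K : Type u) [Field K]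

/-- The generator `X`. -/
def jX : Jacobson K := RingQuot.mkAlgHom K (JRel K) (FreeAlgebra.ι K 0)

/-- The generator `Y`. -/
def jY : Jacobson K := RingQuot.mkAlgHom K (JRel K) (FreeAlgebra.ι K 1)

theorem jX_mul_jY : jX K * jY K = 1 := by
  unfold jX jY
  rw [← map_mul, RingQuot.mkAlgHom_rel K JRel.rel, map_one]

/-- A `K`-linear map commuting with `X` and `Y` is linear over the Jacobson algebra. -/
theorem j_linear {B C : Type u} [AddCommGroup B] [AddCommGroup C] [Module K B] [Module K C]
    [Module (Jacobson K) B] [Module (Jacobson K) C]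
    [IsScalarTower K (Jacobson K) B] [IsScalarTower K (Jacobson K) C]
    (h : B →ₗ[K] C) (hX : ∀ s, h (jX K • s) = jX K • h s)
    (hY : ∀ s, h (jY K • s) = jY K • h s) (r : Jacobson K) (s : B) :
    h (r • s) = r • h s := by
  obtain ⟨r, rfl⟩ := RingQuot.mkAlgHom_surjective K (JRel K) r
  induction r using FreeAlgebra.induction generalizing s with
  | grade0 k => simp [AlgHom.commutes, algebraMap_smul]
  | grade1 i =>
    fin_cases i
    · exact hX s
    · exact hY s
  | mul a b ha hb => rw [map_mul, mul_smul, mul_smul, ha, hb]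
  | add a b ha hb => rw [map_add, add_smul, add_smul, map_add, ha, hb]

/-- A pair of operators with `x * y = 1` is a representation of the Jacobson algebra. -/
def jRep {E : Type u} [AddCommGroup E] [Module K E] (x y : Module.End K E) (hxy : x * y = 1) :
    Jacobson K →ₐ[K] Module.End K E :=
  RingQuot.liftAlgHom K ⟨FreeAlgebra.lift K ![x, y], by
    rintro _ _ ⟨⟩
    simp [hxy]⟩

theorem jRep_X {E : Type u} [AddCommGroup E] [Module K E] (x y : Module.End K E)
    (hxy : x * y = 1) : jRep K x y hxy (jX K) = x := by
  simp [jRep, jX]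

theorem jRep_Y {E : Type u} [AddCommGroup E] [Module K E] (x y : Module.End K E)
    (hxy : x * y = 1) : jRep K x y hxy (jY K) = y := by
  simp [jRep, jY]

/-- Injective modules are retracts of any overmodule, given here by a pair of operators. -/
theorem j_retract {M E : Type u} [AddCommGroup M] [Module K M] [Module (Jacobson K) M]
    [IsScalarTower K (Jacobson K) M] (hM : Module.Injective (Jacobson K) M)
    [AddCommGroup E] [Module K E] (x y : Module.End K E) (hxy : x * y = 1)
    (j : M →ₗ[K] E) (hj : Function.Injective j)
    (hjx : ∀ m, j (jX K • m) = x (j m)) (hjy : ∀ m, j (jY K • m) = y (j m)) :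
    ∃ ρ : E →ₗ[K] M, (∀ m, ρ (j m) = m) ∧ (∀ e, ρ (x e) = jX K • ρ e) ∧
      ∀ e, ρ (y e) = jY K • ρ e := by
  let : Module (Jacobson K) E := Module.compHom E (jRep K x y hxy).toRingHom
  have hsm : ∀ (r : Jacobson K) (e : E), r • e = jRep K x y hxy r e := fun _ _ => rfl
  have : IsScalarTower K (Jacobson K) E := ⟨fun k r e => by
    rw [hsm, hsm, map_smul, LinearMap.smul_apply]⟩
  have hX : ∀ e : E, jX K • e = x e := fun e => by rw [hsm, jRep_X]
  have hY : ∀ e : E, jY K • e = y e := fun e => by rw [hsm, jRep_Y]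
  let j' : M →ₗ[Jacobson K] E :=
    { toFun := j
      map_add' := j.map_add
      map_smul' := j_linear K j (fun m => by rw [hjx, hX]) (fun m => by rw [hjy, hY]) }
  obtain ⟨ρ, hρ⟩ := hM.out j' hj LinearMap.id
  refine ⟨ρ.restrictScalars K, hρ, fun e => ?_, fun e => ?_⟩
  · rw [← hX]; exact ρ.map_smul _ _
  · rw [← hY]; exact ρ.map_smul _ _

/-- The main argument, with explicit compatible `K`-structures. -/
theorem j_main {M Q A B : Type u} [AddCommGroup M] [AddCommGroup Q] [AddCommGroup A]
    [AddCommGroup B] [Module K M] [Module K Q] [Module K A] [Module K B]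
    [Module (Jacobson K) M] [Module (Jacobson K) Q] [Module (Jacobson K) A]
    [Module (Jacobson K) B] [IsScalarTower K (Jacobson K) M] [IsScalarTower K (Jacobson K) Q]
    [IsScalarTower K (Jacobson K) A] [IsScalarTower K (Jacobson K) B]
    (hM : Module.Injective (Jacobson K) M) (p : M →ₗ[Jacobson K] Q)
    (hp : Function.Surjective p) (i : A →ₗ[Jacobson K] B) (hi : Function.Injective i)
    (f : A →ₗ[Jacobson K] Q) : ∃ h : B →ₗ[Jacobson K] Q, ∀ s, h (i s) = f s := by
  have hxy : ∀ {V : Type u} [AddCommGroup V] [Module (Jacobson K) V] (v : V),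
      jX K • jY K • v = v := fun v => by rw [← mul_smul, jX_mul_jY, one_smul]
  obtain ⟨t, ht⟩ := (i.restrictScalars K).exists_leftInverse_of_injective
    (LinearMap.ker_eq_bot.2 hi)
  obtain ⟨σ, hσ⟩ := (p.restrictScalars K).exists_rightInverse_of_surjective
    (LinearMap.range_eq_top.2 hp)
  have ht' : ∀ s, t (i s) = s := fun s => LinearMap.congr_fun ht s
  have hσ' : ∀ q, p (σ q) = q := fun q => LinearMap.congr_fun hσ q
  let g : B →ₗ[K] Q := f.restrictScalars K ∘ₗ t
  have hg : ∀ s, g (i s) = f s := fun s => by simp [g, ht']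
  let L : ∀ (V : Type u) [AddCommGroup V] [Module K V] [Module (Jacobson K) V]
    [IsScalarTower K (Jacobson K) V], Jacobson K → V →ₗ[K] V :=
    fun V _ _ _ _ r => Algebra.lsmul K K V r
  have hL : ∀ {V : Type u} [AddCommGroup V] [Module K V] [Module (Jacobson K) V]
    [IsScalarTower K (Jacobson K) V] (r : Jacobson K) (v : V), L V r v = r • v :=
    fun _ _ => rfl
  clear_value L
  let a : B →ₗ[K] M := σ ∘ₗ (g ∘ₗ L B (jX K) - L Q (jX K) ∘ₗ g)
  let b₀ : B →ₗ[K] M := σ ∘ₗ (g ∘ₗ L B (jY K) - L Q (jY K) ∘ₗ g)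
  let w : B →ₗ[K] M := L M (jX K) ∘ₗ b₀ + a ∘ₗ L B (jY K)
  let b : B →ₗ[K] M := b₀ - L M (jY K) ∘ₗ w
  have ha : ∀ s, a s = σ (g (jX K • s) - jX K • g s) := fun s => by simp [a, hL]
  have hb₀ : ∀ s, b₀ s = σ (g (jY K • s) - jY K • g s) := fun s => by simp [b₀, hL]
  have hw : ∀ s, w s = jX K • b₀ s + a (jY K • s) := fun s => by simp [w, hL]
  have hb : ∀ s, b s = b₀ s - jY K • w s := fun s => by simp [b, hL]
  have hpa : ∀ s, p (a s) = g (jX K • s) - jX K • g s := fun s => by rw [ha, hσ']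
  have hpw : ∀ s, p (w s) = 0 := fun s => by
    rw [hw, map_add, map_smul, hb₀, hσ', hpa, smul_sub, hxy, hxy]; abel
  have hpb : ∀ s, p (b s) = g (jY K • s) - jY K • g s := fun s => by
    rw [hb, map_sub, map_smul, hpw, smul_zero, sub_zero, hb₀, hσ']
  have hrel : ∀ s, jX K • b s + a (jY K • s) = 0 := fun s => by
    rw [hb, smul_sub, hxy, hw]; abel
  have hai : ∀ s, a (i s) = 0 := fun s => by
    rw [ha, ← map_smul, hg, hg, map_smul, sub_self, map_zero]
  have hb₀i : ∀ s, b₀ (i s) = 0 := fun s => by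
    rw [hb₀, ← map_smul, hg, hg, map_smul, sub_self, map_zero]
  have hbi : ∀ s, b (i s) = 0 := fun s => by
    rw [hb, hw, hb₀i, ← map_smul i, hai]; simp
  clear_value a b w b₀ g
  let x : Module.End K (M × B) :=
    (L M (jX K) ∘ₗ LinearMap.fst K M B + a ∘ₗ LinearMap.snd K M B).prod
      (L B (jX K) ∘ₗ LinearMap.snd K M B)
  let y : Module.End K (M × B) :=
    (L M (jY K) ∘ₗ LinearMap.fst K M B + b ∘ₗ LinearMap.snd K M B).prod
      (L B (jY K) ∘ₗ LinearMap.snd K M B)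
  have hx : ∀ m s, x (m, s) = (jX K • m + a s, jX K • s) := fun m s => by simp [x, hL]
  have hy : ∀ m s, y (m, s) = (jY K • m + b s, jY K • s) := fun m s => by simp [y, hL]
  have hxy1 : x * y = 1 := by
    apply LinearMap.ext
    rintro ⟨m, s⟩
    rw [Module.End.mul_apply, hy, hx, smul_add, hxy, hxy, add_assoc, hrel, add_zero]
    rfl
  obtain ⟨ρ, hρ, hρx, hρy⟩ := j_retract K hM x y hxy1 (LinearMap.inl K M B)
    LinearMap.inl_injective
    (fun m => by simp only [LinearMap.inl_apply]; rw [hx]; simp)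
    (fun m => by simp only [LinearMap.inl_apply]; rw [hy]; simp)
  let φ : B →ₗ[K] M := ρ ∘ₗ LinearMap.inr K M B
  have hsplit : ∀ m s, ρ (m, s) = m + φ s := fun m s => by
    have : ((m, s) : M × B) = LinearMap.inl K M B m + LinearMap.inr K M B s := by simp
    rw [this, map_add, hρ]; rfl
  have hφX : ∀ s, a s + φ (jX K • s) = jX K • φ s := fun s => by
    have h := hρx (0, s)
    rw [hx, hsplit, hsplit] at h
    simpa using h
  have hφY : ∀ s, b s + φ (jY K • s) = jY K • φ s := fun s => by
    have h := hρy (0, s)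
    rw [hy, hsplit, hsplit] at h
    simpa using h
  clear_value φ
  let φi : A →ₗ[Jacobson K] M :=
    { toFun := φ ∘ₗ i.restrictScalars K
      map_add' := map_add _
      map_smul' := j_linear K (φ ∘ₗ i.restrictScalars K)
        (fun s => by simp [← hφX, hai]) (fun s => by simp [← hφY, hbi]) }
  obtain ⟨ψ, hψ⟩ := hM.out i hi φi
  have hψ' : ∀ s, ψ (i s) = φ (i s) := hψ
  let h : B →ₗ[K] Q := g + p.restrictScalars K ∘ₗ φ
  have hh : ∀ s, h s = g s + p (φ s) := fun s => rfl
  let h' : B →ₗ[Jacobson K] Q :=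
    { toFun := h
      map_add' := map_add _
      map_smul' := j_linear K h
        (fun s => by
          rw [hh, hh, smul_add, ← map_smul p, ← hφX, map_add, hpa]; abel)
        (fun s => by
          rw [hh, hh, smul_add, ← map_smul p, ← hφY, map_add, hpb]; abel) }
  refine ⟨h' - p ∘ₗ ψ, fun s => ?_⟩
  change h (i s) - p (ψ (i s)) = f s
  rw [hh, hψ', hg]; abel

/-- Over the Jacobson algebra, every quotient of an injective module is injective. -/
theorem jacobson_quotient_of_injective_is_injective
    (M : Type u) [AddCommGroup M] [Module (Jacobson K) M]
    (hM : Module.Injective (Jacobson K) M) (N : Submodule (Jacobson K) M) :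
    Module.Injective (Jacobson K) (M ⧸ N) := by
  let kM (V : Type u) [AddCommGroup V] [Module (Jacobson K) V] : Module K V :=
    Module.compHom V (algebraMap K (Jacobson K))
  have kT (V : Type u) [AddCommGroup V] [Module (Jacobson K) V] :
      @IsScalarTower K (Jacobson K) V _ _ (kM V).toSMul :=
    @IsScalarTower.of_algebraMap_smul K (Jacobson K) V _ _ _ _ (kM V).toSMul
      (fun _ _ => rfl)
  refine ⟨fun A B _ _ _ _ i hi f => ?_⟩
  let := kM M
  let := kM (M ⧸ N)
  let := kM A
  let := kM B
  have := kT M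
  have := kT (M ⧸ N)
  have := kT A
  have := kT B
  exact j_main K hM N.mkQ N.mkQ_surjective i hi f
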